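/- Under the sensitivity model, E[ ξ · T ] = ρ·σ·E[ φ(g(X)) ]; that is, the expectation of the outcome error restricted to the treated event equals ρσ times the expected standard normal density evaluated at g(X). -/

import Mathlib

open MeasureTheory ProbabilityTheory Real

/-- The standard normal density φ(x) = (2π)^{-1/2} exp(-x²/2). -/
noncomputable def stdNormalPDF (x : ℝ) : ℝ :=
  (Real.sqrt (2 * Real.pi))⁻¹ * Real.exp (-x ^ 2 / 2)

/-- The standard normal distribution function Φ(x) = ∫_{-∞}^x φ(t) dt. -/
noncomputable def stdNormalCDF (x : ℝ) : ℝ :=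
  ∫ t in Set.Iic x, stdNormalPDF t

/-- The standard normal density satisfies `φ' = -x φ`. -/
lemma hasDerivAt_stdNormalPDF (x : ℝ) :
    HasDerivAt stdNormalPDF (-(x * stdNormalPDF x)) x := by
  have h : HasDerivAt (fun y : ℝ => -y ^ 2 / 2) (-x) x := by
    convert! ((hasDerivAt_pow 2 x).neg.div_const 2) using 1
    norm_num
    ring
  convert! (h.exp.const_mul (Real.sqrt (2 * Real.pi))⁻¹) using 1
  simp only [stdNormalPDF]
  ring

lemma stdNormalPDF_neg (x : ℝ) : stdNormalPDF (-x) = stdNormalPDF x := by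
  simp [stdNormalPDF]

lemma gaussianPDFReal_zero_one_eq_stdNormalPDF (x : ℝ) :
    gaussianPDFReal 0 1 x = stdNormalPDF x := by
  simp [gaussianPDFReal, stdNormalPDF]

lemma integrable_mul_stdNormalPDF : Integrable (fun x => x * stdNormalPDF x) := by
  have h := (integrable_mul_exp_neg_mul_sq (b := 1 / 2) (by norm_num)).const_mul
    (Real.sqrt (2 * Real.pi))⁻¹
  refine h.congr (Filter.Eventually.of_forall fun x => ?_)
  simp only [stdNormalPDF]
  rw [show -(1 / 2) * x ^ 2 = -x ^ 2 / 2 by ring]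
  ring

lemma tendsto_stdNormalPDF_atTop :
    Filter.Tendsto stdNormalPDF Filter.atTop (nhds 0) := by
  have h : Filter.Tendsto (fun x : ℝ => -x ^ 2 / 2) Filter.atTop Filter.atBot := by
    have h₂ : Filter.Tendsto (fun x : ℝ => x ^ 2 / 2) Filter.atTop Filter.atTop :=
      (Filter.tendsto_pow_atTop two_ne_zero).atTop_div_const two_pos
    simpa only [Function.comp_def, neg_div] using Filter.tendsto_neg_atTop_atBot.comp h₂
  rw [← mul_zero (Real.sqrt (2 * Real.pi))⁻¹]
  exact (Real.tendsto_exp_atBot.comp h).const_mul _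

lemma setIntegral_Ioi_mul_stdNormalPDF (a : ℝ) :
    ∫ x in Set.Ioi a, x * stdNormalPDF x = stdNormalPDF a := by
  have h := integral_Ioi_of_hasDerivAt_of_tendsto' (a := a)
    (fun x _ => hasDerivAt_stdNormalPDF x) integrable_mul_stdNormalPDF.neg.integrableOn
    tendsto_stdNormalPDF_atTop
  rw [integral_neg] at h
  linarith

/-- The first moment of the standard Gaussian restricted to the half-line `(-a, ∞)` is `φ(a)`. -/
lemma integral_gaussianReal_mul_ite (a : ℝ) :
    ∫ y, y * (if 0 < a + y then 1 else 0) ∂(gaussianReal 0 1) = stdNormalPDF a := by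
  rw [integral_gaussianReal_eq_integral_smul one_ne_zero, ← stdNormalPDF_neg,
    ← setIntegral_Ioi_mul_stdNormalPDF, ← integral_indicator measurableSet_Ioi]
  congr 1
  ext y
  by_cases h : 0 < a + y
  · have : -a < y := by linarith
    simp [gaussianPDFReal_zero_one_eq_stdNormalPDF, h, this, mul_comm]
  · have : ¬ -a < y := by linarith
    simp [h, this]

/-- Gaussian selection identity: if `η` is standard Gaussian and independent of `X`, then
`E[η · 1{g(X) + η > 0}] = E[φ(g(X))]`. -/
lemma integral_mul_ite_eq_integral_stdNormalPDF
    {Ω : Type*} [MeasurableSpace Ω] {P : Measure Ω} [IsProbabilityMeasure P]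
    {E : Type*} [MeasurableSpace E] {X : Ω → E} (hX : Measurable X)
    {η : Ω → ℝ} (hη : Measurable η) (hlaw : Measure.map η P = gaussianReal 0 1)
    (hindep : IndepFun η X P) {g : E → ℝ} (hg : Measurable g) :
    ∫ ω, η ω * (if 0 < g (X ω) + η ω then 1 else 0) ∂P = ∫ ω, stdNormalPDF (g (X ω)) ∂P := by
  have : IsProbabilityMeasure (P.map X) := Measure.isProbabilityMeasure_map hX.aemeasurable
  have hmap : P.map (fun ω => (X ω, η ω)) = (P.map X).prod (gaussianReal 0 1) := by
    rw [← hlaw]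
    exact (indepFun_iff_map_prod_eq_prod_map_map hX.aemeasurable hη.aemeasurable).1 hindep.symm
  have hF : Measurable fun p : E × ℝ => p.2 * (if 0 < g p.1 + p.2 then (1 : ℝ) else 0) :=
    measurable_snd.mul (Measurable.ite
      (measurableSet_lt measurable_const ((hg.comp measurable_fst).add measurable_snd))
      measurable_const measurable_const)
  have hid : Integrable (fun y : ℝ => y) (gaussianReal 0 1) :=
    (memLp_id_gaussianReal 1).integrable (by simp)
  have hint : Integrable (fun p : E × ℝ => p.2 * (if 0 < g p.1 + p.2 then (1 : ℝ) else 0))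
      ((P.map X).prod (gaussianReal 0 1)) := by
    refine (hid.comp_snd (P.map X)).mono hF.aestronglyMeasurable
      (Filter.Eventually.of_forall fun p => ?_)
    split_ifs <;> simp
  have hφ : Measurable stdNormalPDF := by
    unfold stdNormalPDF
    fun_prop
  calc ∫ ω, η ω * (if 0 < g (X ω) + η ω then 1 else 0) ∂P
      = ∫ p, p.2 * (if 0 < g p.1 + p.2 then (1 : ℝ) else 0)
          ∂(P.map fun ω => (X ω, η ω)) :=
        (integral_map (hX.prodMk hη).aemeasurable hF.aestronglyMeasurable).symm
    _ = ∫ x, stdNormalPDF (g x) ∂(P.map X) := by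
        rw [hmap, integral_prod _ hint]
        simp only [integral_gaussianReal_mul_ite]
    _ = ∫ ω, stdNormalPDF (g (X ω)) ∂P :=
        integral_map hX.aemeasurable (hφ.comp hg).aestronglyMeasurable

/-- Under the sensitivity model, `E[ξ·T] = ρ·σ·E[φ(g(X))]`: the expectation
of the outcome error restricted to the treated event equals `ρσ` times the expected
standard normal density evaluated at `g(X)`. -/
theorem xi_times_T_expectation
    {Ω : Type*} [MeasurableSpace Ω] {P : Measure Ω} [IsProbabilityMeasure P]
    {E : Type*} [MeasurableSpace E]
    (X : Ω → E) (hX : Measurable X)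
    (η : Ω → ℝ) (hη : Measurable η)
    (hlaw : Measure.map η P = gaussianReal 0 1)
    (hindep : IndepFun η X P)
    (ε : Ω → ℝ) (hε : Measurable ε)
    (hεInt : Integrable ε P) (hεMean : ∫ ω, ε ω ∂P = 0)
    (hεIndep : IndepFun ε (fun ω => (X ω, η ω)) P)
    (ρ σ : ℝ) (hσ : 0 ≤ σ)
    (g : E → ℝ) (hg : Measurable g)
    (ξ : Ω → ℝ) (hξ : ∀ ω, ξ ω = ρ * σ * η ω + ε ω)
    (T : Ω → ℝ) (hT : ∀ ω, T ω = if 0 < g (X ω) + η ω then 1 else 0) :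
    ∫ ω, ξ ω * T ω ∂P = ρ * σ * ∫ ω, stdNormalPDF (g (X ω)) ∂P := by
  have hS : Measurable fun p : E × ℝ => if 0 < g p.1 + p.2 then (1 : ℝ) else 0 :=
    Measurable.ite
      (measurableSet_lt measurable_const ((hg.comp measurable_fst).add measurable_snd))
      measurable_const measurable_const
  have hT_eq : T = fun ω => if 0 < g (X ω) + η ω then 1 else 0 := funext hT
  have hT_meas : Measurable T := hT_eq ▸ hS.comp (hX.prodMk hη)
  have hT_bound : ∀ᵐ ω ∂P, ‖T ω‖ ≤ 1 := Filter.Eventually.of_forall fun ω => by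
    rw [hT]
    split_ifs <;> simp
  have hηInt : Integrable η P := by
    have hid : Integrable (fun y : ℝ => y) (P.map η) :=
      hlaw ▸ (memLp_id_gaussianReal 1).integrable (by simp)
    exact hid.comp_measurable hη
  have hηT : Integrable (fun ω => η ω * T ω) P :=
    hηInt.mul_bdd hT_meas.aestronglyMeasurable hT_bound
  have hεT : Integrable (fun ω => ε ω * T ω) P :=
    hεInt.mul_bdd hT_meas.aestronglyMeasurable hT_bound
  have hε_indep_T : IndepFun ε T P := hT_eq ▸ hεIndep.comp measurable_id hS
  have hεT_zero : ∫ ω, ε ω * T ω ∂P = 0 := by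
    rw [hε_indep_T.integral_fun_mul_eq_mul_integral hε.aestronglyMeasurable
      hT_meas.aestronglyMeasurable, hεMean, zero_mul]
  calc ∫ ω, ξ ω * T ω ∂P
      = ∫ ω, (ρ * σ * (η ω * T ω) + ε ω * T ω) ∂P := by
        congr 1
        ext ω
        rw [hξ]
        ring
    _ = ρ * σ * ∫ ω, η ω * T ω ∂P := by
        rw [integral_add (hηT.const_mul _) hεT, integral_const_mul, hεT_zero, add_zero]
    _ = ρ * σ * ∫ ω, stdNormalPDF (g (X ω)) ∂P := by
        rw [hT_eq, integral_mul_ite_eq_integral_stdNormalPDF hX hη hlaw hindep hg]
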